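/- The quaternionic Tate Gamma function satisfies, for 0 < Re(s) < 1 and each integer N ≥ 0: Γ_N(s) = i^N (2π)^{2-4s} Γ(2s + N/2) / Γ(2(1-s) + N/2), where Γ on the right is Euler's Gamma function. -/

import Mathlib

open Quaternion MeasureTheory
open scoped Real Quaternion ENNReal

noncomputable section

instance : MeasurableSpace ℍ[ℝ] := borel _
instance : BorelSpace ℍ[ℝ] := ⟨rfl⟩

/-- The coordinate Lebesgue measure `dx₀dx₁dx₂dx₃` on `ℍ ≅ ℝ⁴`. -/
def qLeb : Measure ℍ[ℝ] :=
  Measure.map (fun v : Fin 4 → ℝ => (Quaternion.equivTuple ℝ).symm v) volume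

/-- The self-dual Haar measure `dx = 4 dx₀dx₁dx₂dx₃` on `ℍ`. -/
def muH : Measure ℍ[ℝ] := (4 : ℝ≥0∞) • qLeb

/-- The quaternionic Fourier transform with respect to `λ(x) = e^{-4πi Re x}`. -/
def Fq (φ : ℍ[ℝ] → ℂ) (y : ℍ[ℝ]) : ℂ :=
  ∫ x : ℍ[ℝ], φ x * Complex.exp (4 * (π : ℂ) * Complex.I * ((x * y).re : ℝ)) ∂muH

/-- The first complex coordinate `a = x₀ + x₁ i` of a quaternion `x = a + b j`. -/
def ca (x : ℍ[ℝ]) : ℂ := ⟨x.re, x.imI⟩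

/-- The second complex coordinate `b = x₂ + x₃ i` of a quaternion `x = a + b j`. -/
def cb (x : ℍ[ℝ]) : ℂ := ⟨x.imJ, x.imK⟩

/-- The spanning elements `F_j(x) = a^{N-j} b^j |x|^{-N/4}` of `W_N`, extended to `ℍ^×`
radially (`|x| = n(x)²`, so `|x|^{-N/4} = n(x)^{-N/2}`). -/
def FW (N j : ℕ) (x : ℍ[ℝ]) : ℂ :=
  (ca x) ^ (N - j) * (cb x) ^ j * ((normSq x : ℝ) : ℂ) ^ (-(N : ℂ) / 2)

/-- The quaternionic Tate Gamma function `Γ_N(s) = i^N (2π)^{2-4s} Γ(2s+N/2)/Γ(2(1-s)+N/2)`. -/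
def GammaN (N : ℕ) (s : ℂ) : ℂ :=
  Complex.I ^ N * ((2 * (π : ℝ) : ℝ) : ℂ) ^ (2 - 4 * s) *
    Complex.Gamma (2 * s + N / 2) / Complex.Gamma (2 * (1 - s) + N / 2)

section

/-- The Mellin transform of a superposition of decaying exponentials. -/
theorem mellin_integral_mul_exp_neg {X : Type*} [MeasurableSpace X] {μ : Measure X} [SFinite μ]
    {h : X → ℂ} {n : X → ℝ} {w : ℂ} (hw : 0 < w.re) (hn : Measurable n)
    (hpos : ∀ᵐ x ∂μ, 0 < n x) (hh : AEStronglyMeasurable h μ)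
    (hint : Integrable (fun x => h x * (n x : ℂ) ^ (-w)) μ) :
    mellin (fun t => ∫ x, h x * Complex.exp (-(t * n x : ℝ)) ∂μ) w =
      Complex.Gamma w * ∫ x, h x * (n x : ℂ) ^ (-w) ∂μ := by
  have hnorm : ∀ x, ∀ t ∈ Set.Ioi (0 : ℝ),
      ‖h x * ((t : ℂ) ^ (w - 1) * Complex.exp (-(t * n x : ℝ)))‖ =
        ‖h x‖ * (t ^ (w.re - 1) * Real.exp (-(n x * t))) := by
    intro x t ht
    rw [norm_mul, norm_mul, Complex.norm_cpow_eq_rpow_re_of_pos ht, ← Complex.ofReal_neg,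
      ← Complex.ofReal_exp, Complex.norm_real, Real.norm_of_nonneg (Real.exp_pos _).le,
      mul_comm (n x)]
    simp
  have hprod : Integrable (Function.uncurry fun x (t : ℝ) =>
      h x * ((t : ℂ) ^ (w - 1) * Complex.exp (-(t * n x : ℝ))))
      (μ.prod (volume.restrict (Set.Ioi 0))) := by
    have hmeas : AEStronglyMeasurable (Function.uncurry fun x (t : ℝ) =>
        h x * ((t : ℂ) ^ (w - 1) * Complex.exp (-(t * n x : ℝ))))
        (μ.prod (volume.restrict (Set.Ioi 0))) := by
      refine (hh.comp_fst).mul (Measurable.aestronglyMeasurable ?_)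
      fun_prop
    refine (integrable_prod_iff hmeas).2 ⟨?_, ?_⟩
    · filter_upwards [hpos] with x hx
      have h1 : IntegrableOn (fun t : ℝ => t ^ (w.re - 1) * Real.exp (-(n x * t)))
          (Set.Ioi 0) := by
        have := integrableOn_rpow_mul_exp_neg_mul_rpow (s := w.re - 1) (p := 1) (b := n x)
          (by linarith) one_pos hx
        simpa using this
      refine (h1.const_mul ‖h x‖).mono' ?_ ?_
      · refine Measurable.aestronglyMeasurable ?_
        simp only [Function.uncurry]
        fun_prop
      · filter_upwards [ae_restrict_mem measurableSet_Ioi] with t ht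
        exact (hnorm x t ht).le
    · refine (hint.norm.const_mul (Real.Gamma w.re)).congr ?_
      filter_upwards [hpos] with x hx
      simp only [Function.uncurry]
      rw [setIntegral_congr_fun measurableSet_Ioi (hnorm x), integral_const_mul,
        Real.integral_rpow_mul_exp_neg_mul_Ioi hw hx, norm_mul,
        Complex.norm_cpow_eq_rpow_re_of_pos hx, Complex.neg_re, one_div, Real.inv_rpow hx.le,
        Real.rpow_neg hx.le]
      ring
  calc mellin (fun t => ∫ x, h x * Complex.exp (-(t * n x : ℝ)) ∂μ) w
      = ∫ t in Set.Ioi (0 : ℝ), ∫ x,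
          h x * ((t : ℂ) ^ (w - 1) * Complex.exp (-(t * n x : ℝ))) ∂μ := by
        simp only [mellin, smul_eq_mul, ← integral_const_mul]
        congr! 4
        ring
    _ = ∫ x, (∫ t in Set.Ioi (0 : ℝ),
          h x * ((t : ℂ) ^ (w - 1) * Complex.exp (-(t * n x : ℝ)))) ∂μ :=
        (integral_integral_swap hprod).symm
    _ = ∫ x, Complex.Gamma w * (h x * (n x : ℂ) ^ (-w)) ∂μ := by
        refine integral_congr_ae ?_
        filter_upwards [hpos] with x hx
        have := Complex.integral_cpow_mul_exp_neg_mul_Ioi (r := n x) hw (by simpa using hx)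
        rw [integral_const_mul]
        simp only [Complex.ofReal_mul, mul_comm (Complex.ofReal _) (n x : ℂ)]
        rw [this, one_div, Complex.cpow_neg, Complex.inv_cpow]
        · ring
        · rw [Complex.arg_ofReal_of_nonneg hx.le]; exact Real.pi_pos.ne
    _ = _ := integral_const_mul _ _

variable {V : Type*} [NormedAddCommGroup V] [InnerProductSpace ℝ V] [FiniteDimensional ℝ V]
  [MeasurableSpace V] [BorelSpace V]

theorem integrable_norm_pow_mul_exp_neg_mul_sq_norm {b : ℝ} (hb : 0 < b) (k : ℕ) :
    Integrable (fun v : V => ‖v‖ ^ k * Real.exp (-b * ‖v‖ ^ 2)) := by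
  cases subsingleton_or_nontrivial V
  · have : IsFiniteMeasure (volume : Measure V) := inferInstance
    exact Integrable.of_finite
  rw [integrable_fun_norm_addHaar volume (f := fun r : ℝ => r ^ k * Real.exp (-b * r ^ 2))]
  have := (integrable_rpow_mul_exp_neg_mul_sq hb
    (s := ((Module.finrank ℝ V - 1 + k : ℕ) : ℝ)) (neg_one_lt_zero.trans_le
      (Nat.cast_nonneg _))).integrableOn (s := Set.Ioi 0)
  refine this.congr_fun (fun r _ => ?_) measurableSet_Ioi
  simp only [Real.rpow_natCast, pow_add, smul_eq_mul, mul_assoc]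

open FourierTransform in
theorem fourier_complexLinear_mul {f : V → ℂ} (hf : Integrable f)
    (hvf : Integrable fun v => ‖v‖ * ‖f v‖) (p q w : V) :
    𝓕 (fun v => ((inner ℝ v p : ℝ) + Complex.I * (inner ℝ v q : ℝ)) * f v) w =
      Complex.I / (2 * π) * (fderiv ℝ (𝓕 f) w p + Complex.I * fderiv ℝ (𝓕 f) w q) := by
  have key : ∀ m : V, Integrable (fun v => ((inner ℝ v m : ℝ) : ℂ) * f v) := by
    intro m
    refine (hvf.const_mul ‖m‖).mono' ?_ (.of_forall fun v => ?_)
    · have hm : Continuous fun v : V => ((inner ℝ v m : ℝ) : ℂ) := by fun_prop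
      exact hm.aestronglyMeasurable.mul hf.1
    · rw [norm_mul, Complex.norm_real, ← mul_assoc, mul_comm ‖m‖]
      gcongr
      exact norm_inner_le_norm v m
  have hder : ∀ m : V, fderiv ℝ (𝓕 f) w m =
      -(2 * π * Complex.I) * 𝓕 (fun v => ((inner ℝ v m : ℝ) : ℂ) * f v) w := by
    intro m
    rw [Real.fderiv_fourier hf hvf, Real.fourier_continuousLinearMap_apply]
    · simp only [VectorFourier.fourierSMulRight_apply, Real.fourier_eq]
      rw [← integral_const_mul]
      congr! 2 with v
      simp [Circle.smul_def, innerSL_apply_apply ℝ]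
      ring
    · refine (hvf.const_mul (2 * π * ‖innerSL ℝ (E := V)‖)).mono'
        hf.1.fourierSMulRight (.of_forall fun v => ?_)
      exact (VectorFourier.norm_fourierSMulRight_le _ _ _).trans_eq (by ring)
  rw [hder, hder]
  have hadd : 𝓕 (fun v => ((inner ℝ v p : ℝ) + Complex.I * (inner ℝ v q : ℝ)) * f v) w =
      𝓕 (fun v => ((inner ℝ v p : ℝ) : ℂ) * f v) w +
        Complex.I * 𝓕 (fun v => ((inner ℝ v q : ℝ) : ℂ) * f v) w := by
    simp only [Real.fourier_eq]
    rw [← integral_const_mul, ← integral_add]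
    · congr! 2 with v
      simp [Circle.smul_def]
      ring
    · exact (Real.fourierIntegral_convergent_iff w).2 (key p)
    · exact ((Real.fourierIntegral_convergent_iff w).2 (key q)).const_mul _
  rw [hadd]
  have : (π : ℂ) ≠ 0 := by exact_mod_cast Real.pi_ne_zero
  field_simp
  rw [Complex.I_sq]
  ring

open FourierTransform in
theorem fourier_complexLinear_mul_gaussian {b : ℝ} (hb : 0 < b) {Q : V → ℂ}
    (hQ : Differentiable ℝ Q) {k : ℕ} (hgrowth : ∀ v, ‖Q v‖ ≤ ‖v‖ ^ k) {p q : V}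
    (hCR : ∀ w, fderiv ℝ Q w p + Complex.I * fderiv ℝ Q w q = 0) {K : ℂ}
    (hF : ∀ w, 𝓕 (fun v => Q v * Complex.exp (-b * ‖v‖ ^ 2)) w =
      K * (Q w * Complex.exp (-(π ^ 2 / b) * ‖w‖ ^ 2))) (w : V) :
    𝓕 (fun v => ((inner ℝ v p : ℝ) + Complex.I * (inner ℝ v q : ℝ)) * Q v *
        Complex.exp (-b * ‖v‖ ^ 2)) w =
      (-(Complex.I * (π / b)) * K) * (((inner ℝ w p : ℝ) + Complex.I * (inner ℝ w q : ℝ)) * Q w *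
        Complex.exp (-(π ^ 2 / b) * ‖w‖ ^ 2)) := by
  have hnorm : ∀ v : V, ‖Complex.exp (-b * ‖v‖ ^ 2)‖ = Real.exp (-b * ‖v‖ ^ 2) := by
    intro v
    rw [Complex.norm_exp]
    congr 1
    norm_cast
  have hmeas : AEStronglyMeasurable (fun v : V => Q v * Complex.exp (-b * ‖v‖ ^ 2)) :=
    (hQ.continuous.mul (by fun_prop)).aestronglyMeasurable
  have hint : Integrable (fun v : V => Q v * Complex.exp (-b * ‖v‖ ^ 2)) := by
    refine (integrable_norm_pow_mul_exp_neg_mul_sq_norm hb k).mono' hmeas (.of_forall fun v => ?_)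
    rw [norm_mul, hnorm]
    gcongr
    exact hgrowth v
  have hint' : Integrable (fun v : V => ‖v‖ * ‖Q v * Complex.exp (-b * ‖v‖ ^ 2)‖) := by
    refine (integrable_norm_pow_mul_exp_neg_mul_sq_norm hb (k + 1)).mono'
      (continuous_norm.aestronglyMeasurable.mul hmeas.norm) (.of_forall fun v => ?_)
    rw [norm_mul, norm_norm, norm_norm, norm_mul, hnorm, pow_succ' _ k, mul_assoc]
    gcongr
    exact hgrowth v
  have hder : ∀ m : V, fderiv ℝ (𝓕 fun v => Q v * Complex.exp (-b * ‖v‖ ^ 2)) w m =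
      K * ((fderiv ℝ Q w m + Q w * (-(π ^ 2 / b) * (2 * (inner ℝ w m : ℝ)))) *
        Complex.exp (-(π ^ 2 / b) * ‖w‖ ^ 2)) := by
    intro m
    have h1 : HasFDerivAt (fun w : V => ((‖w‖ ^ 2 : ℝ) : ℂ))
        (Complex.ofRealCLM.comp (2 • innerSL ℝ w)) w :=
      Complex.ofRealCLM.hasFDerivAt.comp w (hasStrictFDerivAt_norm_sq w).hasFDerivAt
    have h2 := (((hQ w).hasFDerivAt.mul (h1.const_mul (-(π ^ 2 / b) : ℂ)).cexp)).const_mul K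
    rw [funext hF]
    simp only [Complex.ofReal_pow] at h2
    refine (congrArg (fun L => L m) h2.fderiv).trans ?_
    simp [innerSL_apply_apply ℝ]
    ring
  have := fourier_complexLinear_mul hint hint' p q w
  simp only [← mul_assoc] at this
  rw [this, hder, hder]
  have hpi : (π : ℂ) ≠ 0 := by exact_mod_cast Real.pi_ne_zero
  have hb' : (b : ℂ) ≠ 0 := by exact_mod_cast hb.ne'
  have h3 : fderiv ℝ Q w p = - (Complex.I * fderiv ℝ Q w q) := eq_neg_of_add_eq_zero_left (hCR w)
  rw [h3]
  field_simp
  ring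

end

section Quaternion

/-- The first complex coordinate as a continuous linear map. -/
def caCLM : ℍ[ℝ] →L[ℝ] ℂ :=
  LinearMap.toContinuousLinearMap
    { toFun := ca
      map_add' := fun _ _ => by apply Complex.ext <;> simp [ca]
      map_smul' := fun _ _ => by apply Complex.ext <;> simp [ca] }

/-- The second complex coordinate as a continuous linear map. -/
def cbCLM : ℍ[ℝ] →L[ℝ] ℂ :=
  LinearMap.toContinuousLinearMap
    { toFun := cb
      map_add' := fun _ _ => by apply Complex.ext <;> simp [cb]
      map_smul' := fun _ _ => by apply Complex.ext <;> simp [cb] }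

/-- The quaternion with the given four real coordinates. -/
def quatMk (a b c d : ℝ) : ℍ[ℝ] := ⟨a, b, c, d⟩

theorem inner_quatMk (x : ℍ[ℝ]) (a b c d : ℝ) :
    inner ℝ x (quatMk a b c d) = x.re * a + x.imI * b + x.imJ * c + x.imK * d := by
  refine (Quaternion.inner_def x _).trans ?_
  rw [Quaternion.re_mul, Quaternion.re_star, Quaternion.imI_star, Quaternion.imJ_star,
    Quaternion.imK_star]
  change x.re * a - x.imI * -b - x.imJ * -c - x.imK * -d = _
  ring

theorem ca_eq_inner (x : ℍ[ℝ]) : ca x = (inner ℝ x (quatMk 1 0 0 0) : ℝ) +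
    Complex.I * (inner ℝ x (quatMk 0 1 0 0) : ℝ) := by
  apply Complex.ext <;> simp [ca, inner_quatMk]

theorem cb_eq_inner (x : ℍ[ℝ]) : cb x = (inner ℝ x (quatMk 0 0 1 0) : ℝ) +
    Complex.I * (inner ℝ x (quatMk 0 0 0 1) : ℝ) := by
  apply Complex.ext <;> simp [cb, inner_quatMk]

theorem norm_ca_le (x : ℍ[ℝ]) : ‖ca x‖ ≤ ‖x‖ := by
  refine le_of_sq_le_sq ?_ (norm_nonneg _)
  rw [← Complex.normSq_eq_norm_sq, sq, ← Quaternion.normSq_eq_norm_mul_self, normSq_def']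
  simp only [ca, Complex.normSq_mk]
  nlinarith [sq_nonneg x.imJ, sq_nonneg x.imK]

theorem norm_cb_le (x : ℍ[ℝ]) : ‖cb x‖ ≤ ‖x‖ := by
  refine le_of_sq_le_sq ?_ (norm_nonneg _)
  rw [← Complex.normSq_eq_norm_sq, sq, ← Quaternion.normSq_eq_norm_mul_self, normSq_def']
  simp only [cb, Complex.normSq_mk]
  nlinarith [sq_nonneg x.re, sq_nonneg x.imI]

theorem norm_ca_pow_mul_cb_pow_le (k l : ℕ) (x : ℍ[ℝ]) :
    ‖ca x ^ k * cb x ^ l‖ ≤ ‖x‖ ^ (k + l) := by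
  rw [norm_mul, norm_pow, norm_pow, pow_add]
  gcongr
  · exact norm_ca_le x
  · exact norm_cb_le x

theorem continuous_ca : Continuous ca := caCLM.continuous

theorem continuous_cb : Continuous cb := cbCLM.continuous

theorem differentiable_ca_pow_mul_cb_pow (k l : ℕ) :
    Differentiable ℝ fun x => ca x ^ k * cb x ^ l :=
  (caCLM.differentiable.pow k).mul (cbCLM.differentiable.pow l)

theorem fderiv_ca_pow_mul_cb_pow (k l : ℕ) (x m : ℍ[ℝ]) :
    fderiv ℝ (fun x => ca x ^ k * cb x ^ l) x m =
      ca x ^ k * ((l * cb x ^ (l - 1)) * cb m) + cb x ^ l * ((k * ca x ^ (k - 1)) * ca m) := by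
  have ha : HasFDerivAt ca caCLM x := caCLM.hasFDerivAt
  have hb : HasFDerivAt cb cbCLM x := cbCLM.hasFDerivAt
  refine (congrArg (fun L => L m) ((ha.pow k).mul (hb.pow l)).fderiv).trans ?_
  change ca x ^ k * ((l • cb x ^ (l - 1)) * cb m) + cb x ^ l * ((k • ca x ^ (k - 1)) * ca m) = _
  simp only [nsmul_eq_mul]

open FourierTransform in
/-- A Gaussian times the harmonic polynomial `a ^ k * b ^ l` is an eigenfunction of the Fourier
transform up to rescaling. -/
theorem fourier_ca_pow_mul_cb_pow_mul_gaussian {b : ℝ} (hb : 0 < b) (k l : ℕ) (w : ℍ[ℝ]) :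
    𝓕 (fun v : ℍ[ℝ] => ca v ^ k * cb v ^ l * Complex.exp (-b * ‖v‖ ^ 2)) w =
      (-(Complex.I * (π / b))) ^ (k + l) * (π / b) ^ 2 *
        (ca w ^ k * cb w ^ l * Complex.exp (-(π ^ 2 / b) * ‖w‖ ^ 2)) := by
  induction k generalizing w with
  | zero =>
    induction l generalizing w with
    | zero =>
      simp only [pow_zero, one_mul, add_zero]
      rw [fourier_gaussian_innerProductSpace (by simpa using hb), Quaternion.finrank_eq_four]
      have : ((4 : ℕ) / 2 : ℂ) = (2 : ℕ) := by norm_num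
      rw [this, Complex.cpow_natCast]
      congr 2
      ring
    | succ l ih =>
      have := fourier_complexLinear_mul_gaussian hb
        (differentiable_ca_pow_mul_cb_pow 0 l)
        (norm_ca_pow_mul_cb_pow_le 0 l) (p := quatMk 0 0 1 0) (q := quatMk 0 0 0 1) ?_ ih w
      · simp only [← cb_eq_inner] at this
        convert! this using 2
        · ext v; ring
        · ring
        · ring
      · intro x
        have hp : cb (quatMk 0 0 1 0) = 1 := by apply Complex.ext <;> rfl
        have hq : cb (quatMk 0 0 0 1) = Complex.I := by apply Complex.ext <;> rfl
        rw [fderiv_ca_pow_mul_cb_pow, fderiv_ca_pow_mul_cb_pow, hp, hq]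
        simp
        linear_combination ((l : ℂ) * cb x ^ (l - 1)) * Complex.I_mul_I
  | succ k ih =>
    have := fourier_complexLinear_mul_gaussian hb
      (differentiable_ca_pow_mul_cb_pow k l)
      (norm_ca_pow_mul_cb_pow_le k l) (p := quatMk 1 0 0 0) (q := quatMk 0 1 0 0) ?_ ih w
    · simp only [← ca_eq_inner] at this
      convert! this using 2
      · ext v; ring
      · ring
      · ring
    · intro x
      have hp : cb (quatMk 1 0 0 0) = 0 := by apply Complex.ext <;> rfl
      have hq : cb (quatMk 0 1 0 0) = 0 := by apply Complex.ext <;> rfl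
      have hp' : ca (quatMk 1 0 0 0) = 1 := by apply Complex.ext <;> rfl
      have hq' : ca (quatMk 0 1 0 0) = Complex.I := by apply Complex.ext <;> rfl
      rw [fderiv_ca_pow_mul_cb_pow, fderiv_ca_pow_mul_cb_pow, hp, hq, hp', hq']
      linear_combination (cb x ^ l * ((k : ℂ) * ca x ^ (k - 1))) * Complex.I_mul_I

theorem muH_eq : muH = (4 : ℝ≥0∞) • (volume : Measure ℍ[ℝ]) := by
  rw [muH, qLeb]
  congr 1
  exact (Quaternion.linearIsometryEquivTuple.symm.measurePreserving.comp
    (PiLp.volume_preserving_toLp (Fin 4))).map_eq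

/-- Quaternionic conjugation as a linear isometry. -/
def quatConj : ℍ[ℝ] ≃ₗᵢ[ℝ] ℍ[ℝ] where
  toFun := star
  invFun := star
  map_add' := star_add
  map_smul' r x := by simp
  left_inv := star_star
  right_inv := star_star
  norm_map' := Quaternion.norm_star

theorem integral_comp_star (f : ℍ[ℝ] → ℂ) : ∫ x, f (star x) = ∫ x, f x :=
  quatConj.measurePreserving.integral_comp quatConj.toHomeomorph.measurableEmbedding f

theorem ae_normSq_pos : ∀ᵐ x : ℍ[ℝ], 0 < normSq x := by
  filter_upwards [Measure.ae_ne volume (0 : ℍ[ℝ])] with x hx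
  exact lt_of_le_of_ne normSq_nonneg (Ne.symm (normSq_ne_zero.2 hx))

theorem integrable_ca_pow_mul_cb_pow_mul_schwartz (k l : ℕ) (ψ : SchwartzMap ℍ[ℝ] ℂ) {w : ℂ}
    (h0 : k + l ≤ 2 * w.re) (h4 : 2 * w.re < k + l + 4) :
    Integrable fun x : ℍ[ℝ] => ca x ^ k * cb x ^ l * ψ x * ((normSq x : ℝ) : ℂ) ^ (-w) := by
  have hmeas : AEStronglyMeasurable
      (fun x : ℍ[ℝ] => ca x ^ k * cb x ^ l * ψ x * ((normSq x : ℝ) : ℂ) ^ (-w)) := by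
    refine AEStronglyMeasurable.mul ?_ (Measurable.aestronglyMeasurable ?_)
    · exact (((continuous_ca.pow k).mul (continuous_cb.pow l)).mul
        ψ.continuous).aestronglyMeasurable
    · exact (Complex.measurable_ofReal.comp Quaternion.continuous_normSq.measurable).pow_const _
  have hbound : ∀ x : ℍ[ℝ], x ≠ 0 → ‖ca x ^ k * cb x ^ l * ψ x * ((normSq x : ℝ) : ℂ) ^ (-w)‖ ≤
      ‖ψ x‖ * ‖x‖ ^ (-(2 * w.re - (k + l))) := by
    intro x hx
    have hx' : 0 < ‖x‖ := norm_pos_iff.2 hx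
    have hpow : ‖((normSq x : ℝ) : ℂ) ^ (-w)‖ = ‖x‖ ^ (-(2 * w.re)) := by
      rw [Quaternion.normSq_eq_norm_mul_self, Complex.norm_cpow_eq_rpow_re_of_pos (by positivity),
        Real.mul_rpow hx'.le hx'.le, ← Real.rpow_add hx']
      congr 1
      simp only [Complex.neg_re]
      ring
    calc ‖ca x ^ k * cb x ^ l * ψ x * ((normSq x : ℝ) : ℂ) ^ (-w)‖
        = ‖ca x ^ k * cb x ^ l‖ * (‖ψ x‖ * ‖x‖ ^ (-(2 * w.re))) := by
          rw [norm_mul, norm_mul, hpow, mul_assoc]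
      _ ≤ ‖x‖ ^ (k + l) * (‖ψ x‖ * ‖x‖ ^ (-(2 * w.re))) := by
          gcongr
          exact norm_ca_pow_mul_cb_pow_le k l x
      _ = ‖ψ x‖ * ‖x‖ ^ (-(2 * w.re - (k + l))) := by
          rw [← Real.rpow_natCast, mul_left_comm, ← Real.rpow_add hx']
          push_cast
          congr 2
          ring
  rw [← integrableOn_univ, ← Set.union_compl_self (Metric.ball (0 : ℍ[ℝ]) 1)]
  refine IntegrableOn.union ?_ ?_
  · refine integrableOn_ball_of_norm_le_rpow (C := SchwartzMap.seminorm ℝ 0 0 ψ)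
      (α := 2 * w.re - (k + l)) ?_ ?_ ?_ hmeas
    · simp [Quaternion.finrank_eq_four]
    · rw [Quaternion.finrank_eq_four]
      push_cast
      linarith
    · refine ae_restrict_of_ae ?_
      filter_upwards [Measure.ae_ne volume (0 : ℍ[ℝ])] with x hx
      refine (hbound x hx).trans ?_
      gcongr
      exact SchwartzMap.norm_le_seminorm ℝ ψ x
  · refine Integrable.mono' (ψ.integrable (μ := volume)).norm.integrableOn hmeas.restrict ?_
    filter_upwards [ae_restrict_mem Metric.isOpen_ball.measurableSet.compl] with x hx
    have hx1 : 1 ≤ ‖x‖ := by simpa using hx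
    have hx0 : x ≠ 0 := norm_pos_iff.1 (by linarith)
    refine (hbound x hx0).trans (mul_le_of_le_one_right (norm_nonneg _) ?_)
    exact Real.rpow_le_one_of_one_le_of_nonpos hx1 (by linarith)

open FourierTransform in
theorem integral_ca_pow_mul_cb_pow_mul_fourier_mul_gaussian (k l : ℕ) (φ : SchwartzMap ℍ[ℝ] ℂ)
    {t : ℝ} (ht : 0 < t) :
    ∫ x : ℍ[ℝ], ca x ^ k * cb x ^ l * (𝓕 φ) x * Complex.exp (-(t * normSq x : ℝ)) =
      ((-Complex.I) ^ (k + l) * π ^ (k + l + 2)) * ((t : ℂ) ^ (-((k + l + 2 : ℕ) : ℂ)) *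
        ∫ x : ℍ[ℝ], ca x ^ k * cb x ^ l * φ x *
          Complex.exp (-(π ^ 2 * t⁻¹ * normSq x : ℝ))) := by
  have hint : Integrable (fun v : ℍ[ℝ] => ca v ^ k * cb v ^ l * Complex.exp (-t * ‖v‖ ^ 2)) := by
    refine (integrable_norm_pow_mul_exp_neg_mul_sq_norm ht (k + l)).mono' ?_
      (.of_forall fun v => ?_)
    · have := continuous_ca
      have := continuous_cb
      exact Continuous.aestronglyMeasurable (by fun_prop)
    · rw [norm_mul, Complex.norm_exp]
      gcongr
      · exact norm_ca_pow_mul_cb_pow_le k l v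
      · norm_cast
  have hmul : ∫ ξ : ℍ[ℝ], 𝓕 (fun v : ℍ[ℝ] => ca v ^ k * cb v ^ l *
      Complex.exp (-t * ‖v‖ ^ 2)) ξ * φ ξ =
      ∫ x : ℍ[ℝ], ca x ^ k * cb x ^ l * Complex.exp (-t * ‖x‖ ^ 2) * (𝓕 φ) x := by
    simpa using! VectorFourier.integral_fourierIntegral_smul_eq_flip (L := innerₗ ℍ[ℝ])
      Real.continuous_fourierChar continuous_inner hint (φ.integrable (μ := volume))
  calc ∫ x : ℍ[ℝ], ca x ^ k * cb x ^ l * (𝓕 φ) x * Complex.exp (-(t * normSq x : ℝ))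
      = ∫ x : ℍ[ℝ], ca x ^ k * cb x ^ l * Complex.exp (-t * ‖x‖ ^ 2) * (𝓕 φ) x := by
        refine integral_congr_ae (.of_forall fun x => ?_)
        simp only [Quaternion.normSq_eq_norm_mul_self]
        push_cast
        ring_nf
    _ = ∫ x : ℍ[ℝ], ((-Complex.I) ^ (k + l) * π ^ (k + l + 2)) *
          ((t : ℂ) ^ (-((k + l + 2 : ℕ) : ℂ)) * (ca x ^ k * cb x ^ l * φ x *
            Complex.exp (-(π ^ 2 * t⁻¹ * normSq x : ℝ)))) := by
        rw [← hmul]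
        refine integral_congr_ae (.of_forall fun x => ?_)
        simp only [fourier_ca_pow_mul_cb_pow_mul_gaussian ht,
          Quaternion.normSq_eq_norm_mul_self]
        have hexp : Complex.exp (-(π ^ 2 * t⁻¹ * (‖x‖ * ‖x‖) : ℝ)) =
            Complex.exp (-(π ^ 2 / t) * ‖x‖ ^ 2) := by
          push_cast
          ring_nf
        have hconst : (-(Complex.I * (π / t))) ^ (k + l) * ((π : ℂ) / t) ^ 2 =
            (-Complex.I) ^ (k + l) * π ^ (k + l + 2) * ((t : ℂ) ^ (k + l + 2))⁻¹ := by
          rw [← neg_mul, mul_pow, mul_assoc, ← pow_add, div_pow, div_eq_mul_inv, mul_assoc]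
        rw [hexp, hconst, Complex.cpow_neg, Complex.cpow_natCast]
        ring
    _ = _ := by rw [integral_const_mul, integral_const_mul]

theorem mellin_integral_ca_pow_mul_cb_pow_mul_schwartz (k l : ℕ) {s : ℂ} (hs0 : 0 < s.re)
    (hs1 : s.re < 1) (ψ : SchwartzMap ℍ[ℝ] ℂ) :
    mellin (fun t => ∫ x : ℍ[ℝ], ca x ^ k * cb x ^ l * ψ x *
        Complex.exp (-(t * normSq x : ℝ))) (2 * s + (k + l : ℕ) / 2) =
      Complex.Gamma (2 * s + (k + l : ℕ) / 2) * ∫ x : ℍ[ℝ], ca x ^ k * cb x ^ l * ψ x *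
        ((normSq x : ℝ) : ℂ) ^ (-(2 * s + (k + l : ℕ) / 2)) := by
  have hre : (2 * s + (k + l : ℕ) / 2).re = 2 * s.re + (k + l) / 2 := by
    have : ((k + l : ℕ) / 2 : ℂ) = (((k + l) / 2 : ℝ) : ℂ) := by push_cast; ring
    rw [this]
    simp
  have hkl : (0 : ℝ) ≤ k + l := by positivity
  generalize 2 * s + (k + l : ℕ) / 2 = z at hre ⊢
  refine mellin_integral_mul_exp_neg (by linarith)
    Quaternion.continuous_normSq.measurable ae_normSq_pos ?_
    (integrable_ca_pow_mul_cb_pow_mul_schwartz k l ψ (by linarith) (by linarith))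
  exact (((continuous_ca.pow k).mul
    (continuous_cb.pow l)).mul ψ.continuous).aestronglyMeasurable

theorem mellin_eq_of_inversion {F G : ℝ → ℂ} {c m : ℂ} {r : ℝ} (hr : 0 < r)
    (h : ∀ t : ℝ, 0 < t → F t = c * ((t : ℂ) ^ (-m) * G (r * t⁻¹))) (z : ℂ) :
    mellin F z = c * ((r : ℂ) ^ (-(m - z)) * mellin G (m - z)) := by
  have hF : mellin F z =
      mellin (fun t => c • ((t : ℂ) ^ (-m) • (fun u => G (r * u)) t⁻¹)) z :=
    setIntegral_congr_fun measurableSet_Ioi fun t ht => by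
      simp only [smul_eq_mul, h t ht]
  rw [hF, mellin_const_smul, mellin_cpow_smul, mellin_comp_inv fun u => G (r * u),
    mellin_comp_mul_left _ _ hr, smul_eq_mul, smul_eq_mul, show -(z + -m) = m - z by ring]

open FourierTransform in
/-- The functional equation for `a ^ k * b ^ l` and the standard Fourier transform. -/
theorem Gamma_mul_integral_fourier_mul_normSq_cpow (k l : ℕ) {s : ℂ} (hs0 : 0 < s.re)
    (hs1 : s.re < 1) (φ : SchwartzMap ℍ[ℝ] ℂ) :
    Complex.Gamma (2 * (1 - s) + (k + l : ℕ) / 2) *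
      ∫ x : ℍ[ℝ], ca x ^ k * cb x ^ l * (𝓕 φ) x *
        ((normSq x : ℝ) : ℂ) ^ (-(2 * (1 - s) + (k + l : ℕ) / 2)) =
      (-Complex.I) ^ (k + l) * (π : ℂ) ^ (2 - 4 * s) *
        (Complex.Gamma (2 * s + (k + l : ℕ) / 2) * ∫ x : ℍ[ℝ], ca x ^ k * cb x ^ l * φ x *
          ((normSq x : ℝ) : ℂ) ^ (-(2 * s + (k + l : ℕ) / 2))) := by
  rw [← mellin_integral_ca_pow_mul_cb_pow_mul_schwartz k l (s := 1 - s) (by simpa using hs1)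
      (by simpa using hs0) (𝓕 φ),
    ← mellin_integral_ca_pow_mul_cb_pow_mul_schwartz k l hs0 hs1 φ]
  rw [mellin_eq_of_inversion
    (G := fun t => ∫ x : ℍ[ℝ], ca x ^ k * cb x ^ l * φ x * Complex.exp (-(t * normSq x : ℝ)))
    (by positivity : 0 < π ^ 2)
    fun t ht => integral_ca_pow_mul_cb_pow_mul_fourier_mul_gaussian k l φ ht]
  have hpi : (π : ℂ) ≠ 0 := by exact_mod_cast Real.pi_ne_zero
  have harg : ((k + l + 2 : ℕ) : ℂ) - (2 * (1 - s) + (k + l : ℕ) / 2) =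
      2 * s + (k + l : ℕ) / 2 := by
    push_cast
    ring
  have hpow : (π : ℂ) ^ (k + l + 2) *
      ((π ^ 2 : ℝ) : ℂ) ^ (-(2 * s + (k + l : ℕ) / 2)) = (π : ℂ) ^ (2 - 4 * s) := by
    rw [sq, Complex.ofReal_mul, Complex.mul_cpow_ofReal_nonneg Real.pi_pos.le
      Real.pi_pos.le, ← Complex.cpow_natCast, ← Complex.cpow_add _ _ hpi,
      ← Complex.cpow_add _ _ hpi]
    congr 1
    push_cast
    ring
  rw [harg, ← hpow]
  ring

open FourierTransform in
theorem Fq_eq_fourier (φ : SchwartzMap ℍ[ℝ] ℂ) (y : ℍ[ℝ]) :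
    Fq φ y = 4 * (𝓕 φ) ((-2 : ℝ) • star y) := by
  rw [Fq, muH_eq, integral_smul_measure, SchwartzMap.fourier_coe, Real.fourier_eq']
  have : ((4 : ℝ≥0∞).toReal : ℝ) = 4 := by simp
  rw [this, Complex.real_smul]
  push_cast
  congr 2 with x
  have hinner : inner ℝ x ((-2 : ℝ) • star y) = -2 * (x * y).re := by
    rw [inner_smul_right]
    congr 1
    exact (Quaternion.inner_def x _).trans (by rw [star_star])
  rw [hinner, smul_eq_mul, mul_comm]
  push_cast
  ring_nf

theorem ca_real_smul (r : ℝ) (x : ℍ[ℝ]) : ca (r • x) = r * ca x :=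
  (caCLM.map_smul r x).trans (Complex.real_smul)

theorem cb_real_smul (r : ℝ) (x : ℍ[ℝ]) : cb (r • x) = r * cb x :=
  (cbCLM.map_smul r x).trans (Complex.real_smul)

theorem normSq_real_smul (r : ℝ) (x : ℍ[ℝ]) : normSq (r • x) = r ^ 2 * normSq x := by
  simp [Quaternion.normSq_def']
  ring

theorem FW_mul_cpow {N j : ℕ} {x : ℍ[ℝ]} (hx : 0 < normSq x) (z : ℂ) :
    FW N j x * ((normSq x : ℝ) : ℂ) ^ (-z) =
      ca x ^ (N - j) * cb x ^ j * ((normSq x : ℝ) : ℂ) ^ (-(z + N / 2)) := by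
  have hx' : ((normSq x : ℝ) : ℂ) ≠ 0 := by exact_mod_cast hx.ne'
  rw [FW, mul_assoc, ← Complex.cpow_add _ _ hx']
  congr 2
  ring

theorem FW_inv_mul_cpow {N j : ℕ} (hj : j ≤ N) {y : ℍ[ℝ]} (hy : 0 < normSq y) (s : ℂ) :
    FW N j y⁻¹ * ((normSq y : ℝ) : ℂ) ^ (2 * (s - 1)) =
      ca (star y) ^ (N - j) * cb (star y) ^ j *
        ((normSq (star y) : ℝ) : ℂ) ^ (-(2 * (1 - s) + N / 2)) := by
  have hy' : ((normSq y : ℝ) : ℂ) ≠ 0 := by exact_mod_cast hy.ne'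
  have hinv : y⁻¹ = (normSq y)⁻¹ • star y := rfl
  have hns : normSq ((normSq y)⁻¹ • star y) = (normSq y)⁻¹ := by
    rw [normSq_real_smul, normSq_star]
    field_simp
  rw [FW, hinv, hns, ca_real_smul, cb_real_smul, normSq_star, mul_pow, mul_pow]
  have h1 : ((((normSq y)⁻¹ : ℝ) : ℂ)) ^ (N - j) * (((normSq y)⁻¹ : ℝ) : ℂ) ^ j =
      ((normSq y : ℝ) : ℂ) ^ (-(N : ℂ)) := by
    rw [← pow_add, Nat.sub_add_cancel hj, Complex.cpow_neg, Complex.cpow_natCast,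
      Complex.ofReal_inv, inv_pow]
  have h2 : (((normSq y)⁻¹ : ℝ) : ℂ) ^ (-(N : ℂ) / 2) = ((normSq y : ℝ) : ℂ) ^ ((N : ℂ) / 2) := by
    rw [Complex.ofReal_inv, Complex.inv_cpow, ← Complex.cpow_neg]
    · congr 1
      ring
    · rw [Complex.arg_ofReal_of_nonneg hy.le]
      exact Real.pi_pos.ne
  have h3 : ((normSq y : ℝ) : ℂ) ^ (-(2 * (1 - s) + N / 2)) =
      ((normSq y : ℝ) : ℂ) ^ (-(N : ℂ)) * ((normSq y : ℝ) : ℂ) ^ ((N : ℂ) / 2) *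
        ((normSq y : ℝ) : ℂ) ^ (2 * (s - 1)) := by
    rw [← Complex.cpow_add _ _ hy', ← Complex.cpow_add _ _ hy']
    congr 1
    ring
  rw [h3, ← h1, h2]
  ring

open FourierTransform in
theorem integral_FW_inv_mul_Fq {N j : ℕ} (hj : j ≤ N) (s : ℂ) (φ : SchwartzMap ℍ[ℝ] ℂ) :
    ∫ y : ℍ[ℝ], FW N j y⁻¹ * ((normSq y : ℝ) : ℂ) ^ (2 * (s - 1)) * Fq φ y ∂muH =
      (-1) ^ N * 4 * (2 : ℂ) ^ (2 - 4 * s) *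
        ∫ x : ℍ[ℝ], ca x ^ (N - j) * cb x ^ j * (𝓕 φ) x *
          ((normSq x : ℝ) : ℂ) ^ (-(2 * (1 - s) + N / 2)) := by
  set G : ℍ[ℝ] → ℂ := fun x => ca x ^ (N - j) * cb x ^ j * (𝓕 φ) x *
    ((normSq x : ℝ) : ℂ) ^ (-(2 * (1 - s) + N / 2)) with hG
  have h2 : (2 : ℂ) ≠ 0 := two_ne_zero
  have hconst : (16 : ℂ) * (2 : ℂ) ^ (2 - 4 * s) * (-1) ^ N * (-2) ^ N *
      ((4 : ℝ) : ℂ) ^ (-(2 * (1 - s) + N / 2)) = 4 := by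
    have h4 : ((4 : ℝ) : ℂ) ^ (-(2 * (1 - s) + (N : ℂ) / 2)) =
        ((2 : ℂ) ^ (2 - 4 * s) * 2 ^ N * 4)⁻¹ := by
      have : ((4 : ℝ) : ℂ) = ((2 : ℝ) : ℂ) * ((2 : ℝ) : ℂ) := by push_cast; norm_num
      rw [this, Complex.mul_cpow_ofReal_nonneg zero_le_two zero_le_two, Complex.ofReal_ofNat,
        ← Complex.cpow_add _ _ h2]
      have h22 : (2 : ℂ) ^ N * 4 = 2 ^ ((N + 2 : ℕ) : ℂ) := by
        rw [Complex.cpow_natCast, pow_add]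
        norm_num
      rw [mul_assoc, h22, ← Complex.cpow_add _ _ h2, ← Complex.cpow_neg]
      congr 1
      push_cast
      ring
    have hne : (2 : ℂ) ^ (2 - 4 * s) ≠ 0 := by simp [Complex.cpow_eq_zero_iff]
    rw [h4]
    have : (-1 : ℂ) ^ N * (-2) ^ N = 2 ^ N := by rw [← mul_pow]; norm_num
    rw [mul_assoc _ ((-1 : ℂ) ^ N), this]
    field_simp
    norm_num
  have hpt : ∀ y : ℍ[ℝ], 0 < normSq y →
      FW N j y⁻¹ * ((normSq y : ℝ) : ℂ) ^ (2 * (s - 1)) * Fq φ y =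
        16 * (2 : ℂ) ^ (2 - 4 * s) * (-1) ^ N * G ((-2 : ℝ) • star y) := by
    intro y hy
    rw [FW_inv_mul_cpow hj hy, Fq_eq_fourier]
    simp only [hG]
    rw [ca_real_smul, cb_real_smul, normSq_real_smul, mul_pow, mul_pow, Complex.ofReal_mul,
      Complex.mul_cpow_ofReal_nonneg (by norm_num) normSq_nonneg]
    have h4 : ((-2 : ℝ) ^ 2) = 4 := by norm_num
    have hN : ((-2 : ℝ) : ℂ) ^ (N - j) * ((-2 : ℝ) : ℂ) ^ j = (-2) ^ N := by
      rw [← pow_add, Nat.sub_add_cancel hj]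
      norm_num
    rw [h4]
    linear_combination (-(ca (star y) ^ (N - j) * cb (star y) ^ j *
      ((normSq (star y) : ℝ) : ℂ) ^ (-(2 * (1 - s) + N / 2)) * (𝓕 φ) ((-2 : ℝ) • star y))) *
      (hconst + (16 * (2 : ℂ) ^ (2 - 4 * s) * (-1) ^ N *
        ((4 : ℝ) : ℂ) ^ (-(2 * (1 - s) + (N : ℂ) / 2))) * hN)
  have hscale : ∫ y : ℍ[ℝ], G ((-2 : ℝ) • y) = 16⁻¹ * ∫ y, G y := by
    rw [Measure.integral_comp_smul, Quaternion.finrank_eq_four, Complex.real_smul]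
    norm_num
  rw [muH_eq, integral_smul_measure, integral_congr_ae (ae_normSq_pos.mono hpt),
    integral_const_mul, integral_comp_star fun y => G ((-2 : ℝ) • y), hscale, Complex.real_smul]
  simp
  ring

end Quaternion

/-- **Tate's local functional equation for quaternions** (Theorem 3.9):
for `F ∈ W_N` and `0 < Re s < 1`, as tempered distributions
`F(F(1/x)|x|^{s-1}) = Γ_N(s) F(x)|x|^{-s}`, i.e. tested against any Schwartz function `φ`:
`∫ F(y⁻¹)|y|^{s-1} (Fφ)(y) dy = Γ_N(s) ∫ F(x)|x|^{-s} φ(x) dx`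
(here `|x| = n(x)²`, so `|y|^{s-1} = n(y)^{2(s-1)}` and `|x|^{-s} = n(x)^{-2s}`). -/
theorem stmt15 (N j : ℕ) (hj : j ≤ N) (s : ℂ) (hs0 : 0 < s.re) (hs1 : s.re < 1)
    (φ : SchwartzMap ℍ[ℝ] ℂ) :
    ∫ y : ℍ[ℝ], FW N j y⁻¹ * ((normSq y : ℝ) : ℂ) ^ (2 * (s - 1)) * Fq (⇑φ) y ∂muH =
      GammaN N s * ∫ x : ℍ[ℝ], FW N j x * ((normSq x : ℝ) : ℂ) ^ (-(2 * s)) * φ x ∂muH := by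
  have hcore := Gamma_mul_integral_fourier_mul_normSq_cpow (N - j) j hs0 hs1 φ
  rw [Nat.sub_add_cancel hj] at hcore
  have hGamma : Complex.Gamma (2 * (1 - s) + N / 2) ≠ 0 := by
    refine Complex.Gamma_ne_zero_of_re_pos ?_
    have : (2 * (1 - s) + N / 2 : ℂ).re = 2 * (1 - s.re) + N / 2 := by
      have : (N / 2 : ℂ) = ((N / 2 : ℝ) : ℂ) := by push_cast; ring
      rw [this]
      simp
    rw [this]
    have : (0 : ℝ) ≤ N := N.cast_nonneg
    linarith
  have hR : ∫ x : ℍ[ℝ], FW N j x * ((normSq x : ℝ) : ℂ) ^ (-(2 * s)) * φ x ∂muH =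
      4 * ∫ x : ℍ[ℝ], ca x ^ (N - j) * cb x ^ j * φ x *
          ((normSq x : ℝ) : ℂ) ^ (-(2 * s + (N : ℂ) / 2)) := by
    rw [muH_eq, integral_smul_measure, Complex.real_smul]
    congr 1
    refine integral_congr_ae (ae_normSq_pos.mono fun x hx => ?_)
    simp only [FW_mul_cpow hx]
    ring
  have htwo : ((2 * π : ℝ) : ℂ) ^ (2 - 4 * s) = 2 ^ (2 - 4 * s) * (π : ℂ) ^ (2 - 4 * s) := by
    rw [Complex.ofReal_mul, Complex.mul_cpow_ofReal_nonneg zero_le_two Real.pi_pos.le,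
      Complex.ofReal_ofNat]
  have hI : (-1 : ℂ) ^ N * (-Complex.I) ^ N = Complex.I ^ N := by
    rw [← mul_pow]
    simp
  rw [integral_FW_inv_mul_Fq hj, hR, GammaN, htwo, ← hI, div_mul_eq_mul_div, eq_div_iff hGamma]
  linear_combination ((-1) ^ N * 4 * (2 : ℂ) ^ (2 - 4 * s)) * hcore
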